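/- Bias-learning universal approximation for single-hidden-layer residual networks: Let d ≥ 1 be a natural number (input and output dimensions equal), let U ⊆ ℝ^d be compact, let h : ℝ^d → ℝ^d be continuous, and let ε > 0, δ ∈ (0,1), and R > 0. Then there exists a hidden-layer width m ∈ ℕ such that, if all entries of the weight matrices A ∈ ℝ^{d×m} and B ∈ ℝ^{m×d} are mutually independent random variables each uniformly distributed on [−R, R], then with probability at least 1 − δ there exists a bias vector b ∈ ℝ^m with ∫_U ‖h(x) − (x + A·ReLU(Bx + b))‖ dx ≤ ε, where the integral is with respect to Lebesgue measure on ℝ^d. -/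

import Mathlib

open MeasureTheory

/-- The ReLU activation function. -/
noncomputable def relu (t : ℝ) : ℝ := max t 0

/-- The uniform probability measure on the interval `[-R, R]`. -/
noncomputable def unif (R : ℝ) : Measure ℝ :=
  (volume (Set.Icc (-R) R))⁻¹ • volume.restrict (Set.Icc (-R) R)

/-- Index type for the weights of a width-`m` single-hidden-layer res-net with input
and output dimension `d`: output entries and input entries. -/
abbrev ResWeightIdx (m d : ℕ) := (Fin d × Fin m) ⊕ (Fin m × Fin d)

lemma relu_continuous : Continuous relu := by
  unfold relu; fun_prop

lemma relu_of_nonneg {t : ℝ} (h : 0 ≤ t) : relu t = t := max_eq_left h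
lemma relu_of_nonpos {t : ℝ} (h : t ≤ 0) : relu t = 0 := max_eq_right h

lemma exp_repr (M t : ℝ) (h1 : -M ≤ t) (h2 : t ≤ M) :
    Real.exp t = Real.exp (-M) * (1 + M) + Real.exp (-M) * t
      + ∫ s in (-M)..M, Real.exp s * relu (t - s) := by
  have hc : Continuous fun s : ℝ => Real.exp s * relu (t - s) :=
    Real.continuous_exp.mul (relu_continuous.comp (by fun_prop))
  rw [← intervalIntegral.integral_add_adjacent_intervals (b := t)
    (hc.intervalIntegrable _ _) (hc.intervalIntegrable _ _)]
  have e2 : ∫ s in t..M, Real.exp s * relu (t - s) = 0 := by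
    rw [intervalIntegral.integral_congr (g := fun _ => 0)]
    · simp
    · intro s hs
      rw [Set.uIcc_of_le h2] at hs
      simp [relu_of_nonpos (sub_nonpos.2 hs.1)]
  have e1 : ∫ s in (-M)..t, Real.exp s * relu (t - s)
      = ∫ s in (-M)..t, Real.exp s * (t - s) := by
    apply intervalIntegral.integral_congr
    intro s hs
    rw [Set.uIcc_of_le h1] at hs
    simp [relu_of_nonneg (sub_nonneg.2 hs.2)]
  have e3 : ∫ s in (-M)..t, Real.exp s * (t - s)
      = (Real.exp t * (t - t) + Real.exp t) - (Real.exp (-M) * (t - (-M)) + Real.exp (-M)) := by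
    apply intervalIntegral.integral_eq_sub_of_hasDerivAt
      (f := fun s => Real.exp s * (t - s) + Real.exp s)
    · intro s _
      have := ((Real.hasDerivAt_exp s).mul ((hasDerivAt_id s).const_sub t)).add
        (Real.hasDerivAt_exp s)
      refine (this.congr_deriv ?_)
      simp only [id]; ring
    · exact (by fun_prop : Continuous fun s : ℝ => Real.exp s * (t - s)).intervalIntegrable _ _
  rw [e1, e2, e3]; ring

section

variable {d : ℕ} {U : Set (Fin d → ℝ)}

lemma lin_cont (w : Fin d → ℝ) : Continuous fun x : U => ∑ q, w q * x.1 q :=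
  continuous_finsetSum _ fun q _ =>
    continuous_const.mul ((continuous_apply q).comp continuous_subtype_val)

noncomputable def lin (w : Fin d → ℝ) : C(U, ℝ) := ⟨fun x => ∑ q, w q * x.1 q, lin_cont w⟩

noncomputable def neur (w : Fin d → ℝ) (b : ℝ) : C(U, ℝ) :=
  ⟨fun x => relu (∑ q, w q * x.1 q + b), relu_continuous.comp ((lin_cont w).add continuous_const)⟩

noncomputable def neurSpan (U : Set (Fin d → ℝ)) : Submodule ℝ C(U, ℝ) :=
  Submodule.span ℝ (Set.range fun wb : (Fin d → ℝ) × ℝ => neur wb.1 wb.2)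

noncomputable def expo (U : Set (Fin d → ℝ)) : Multiplicative (Fin d → ℝ) →* C(U, ℝ) where
  toFun w := ⟨fun x => Real.exp (∑ q, w.toAdd q * x.1 q), Real.continuous_exp.comp (lin_cont _)⟩
  map_one' := by ext x; simp
  map_mul' w v := by
    ext x; simp [add_mul, Finset.sum_add_distrib, Real.exp_add]

lemma neur_mem (w : Fin d → ℝ) (b : ℝ) : (neur w b : C(U, ℝ)) ∈ neurSpan U :=
  Submodule.subset_span ⟨(w, b), rfl⟩

lemma expo_mem [CompactSpace U] (w : Multiplicative (Fin d → ℝ)) :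
    expo U w ∈ (neurSpan U).topologicalClosure := by
  set V := (neurSpan U).topologicalClosure with hV
  have hsub : neurSpan U ≤ V := Submodule.le_topologicalClosure _
  obtain ⟨M, hM⟩ : ∃ M : ℝ, ∀ x : U, |∑ q, w.toAdd q * x.1 q| ≤ M := by
    refine ⟨‖(lin w.toAdd : C(U, ℝ))‖, fun x => ?_⟩
    exact (lin w.toAdd : C(U, ℝ)).norm_coe_le_norm x
  have hGc : Continuous fun s : ℝ => Real.exp s • (neur w.toAdd (-s) : C(U, ℝ)) := by
    refine Real.continuous_exp.smul ?_
    refine ContinuousMap.continuous_of_continuous_uncurry _ ?_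
    exact relu_continuous.comp (((lin_cont w.toAdd).comp continuous_snd).add continuous_fst.neg)
  let G : ℝ → V := fun s => ⟨Real.exp s • (neur w.toAdd (-s) : C(U, ℝ)),
    V.smul_mem _ (hsub (neur_mem _ _))⟩
  have hG : Continuous G := hGc.subtype_mk _
  have : CompleteSpace V := (Submodule.isClosed_topologicalClosure _).completeSpace_coe
  have hint : (∫ s in (-M)..M, Real.exp s • (neur w.toAdd (-s) : C(U, ℝ))) ∈ V := by
    have := ContinuousLinearMap.intervalIntegral_comp_comm (𝕜 := ℝ) (E := V) (F := C(U, ℝ)) V.subtypeL (hG.intervalIntegrable (μ := volume) (-M) M)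
    simp only [Submodule.subtypeL_apply, G] at this
    rw [this]; exact Subtype.prop _
  have key : expo U w = (Real.exp (-M) * (1 + M)) • (neur 0 1 : C(U, ℝ))
      + Real.exp (-M) • ((neur w.toAdd 0 : C(U, ℝ)) - neur (-w.toAdd) 0)
      + ∫ s in (-M)..M, Real.exp s • (neur w.toAdd (-s) : C(U, ℝ)) := by
    ext x
    have h0 := (ContinuousMap.evalCLM ℝ x).intervalIntegral_comp_comm
      (hGc.intervalIntegrable (μ := volume) (-M) M)
    have h0' : (∫ s in (-M)..M, Real.exp s • (neur w.toAdd (-s) : C(U, ℝ))) x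
      = ∫ s in (-M)..M, Real.exp s * relu (∑ q, w.toAdd q * x.1 q - s) := h0.symm
    have h1 : relu (∑ q, w.toAdd q * x.1 q) - relu (-∑ q, w.toAdd q * x.1 q)
        = ∑ q, w.toAdd q * x.1 q := by
      unfold relu
      rcases le_total 0 (∑ q, w.toAdd q * x.1 q) with h | h
      · rw [max_eq_left h, max_eq_right (by linarith)]; ring
      · rw [max_eq_right h, max_eq_left (by linarith)]; ring
    have h2 := exp_repr M _ (abs_le.1 (hM x)).1 (abs_le.1 (hM x)).2
    have h3 : relu 1 = 1 := relu_of_nonneg zero_le_one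
    simp only [ContinuousMap.add_apply, ContinuousMap.smul_apply, ContinuousMap.sub_apply, h0']
    simp only [expo, neur, MonoidHom.coe_mk, OneHom.coe_mk, ContinuousMap.coe_mk, smul_eq_mul,
      Pi.zero_apply, zero_mul, Finset.sum_const_zero, zero_add, add_zero, Pi.neg_apply, neg_mul,
      Finset.sum_neg_distrib, h1, h3, mul_one]
    exact h2
  rw [key]
  exact V.add_mem (V.add_mem (V.smul_mem _ (hsub (neur_mem _ _)))
    (V.smul_mem _ (V.sub_mem (hsub (neur_mem _ _)) (hsub (neur_mem _ _))))) hint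

lemma neur_dense [CompactSpace U] : (neurSpan U).topologicalClosure = ⊤ := by
  have hsep : (Algebra.adjoin ℝ (MonoidHom.mrange (expo U) : Set C(U, ℝ))).SeparatesPoints := by
    intro x y hxy
    obtain ⟨q, hq⟩ : ∃ q, x.1 q ≠ y.1 q := by
      by_contra! hc
      exact hxy (Subtype.ext (funext hc))
    refine ⟨_, ⟨expo U (Multiplicative.ofAdd (Pi.single q 1)),
      Algebra.subset_adjoin ⟨_, rfl⟩, rfl⟩, ?_⟩
    simpa [expo, Pi.single_apply] using hq
  have htop := ContinuousMap.subalgebra_topologicalClosure_eq_top_of_separatesPoints _ hsep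
  rw [eq_top_iff]
  intro f _
  have hf : f ∈ (Algebra.adjoin ℝ (MonoidHom.mrange (expo U) : Set C(U, ℝ))).topologicalClosure := by
    rw [htop]; trivial
  have hle : (Algebra.adjoin ℝ (MonoidHom.mrange (expo U) : Set C(U, ℝ)) : Set C(U, ℝ))
      ⊆ (neurSpan U).topologicalClosure := by
    intro g hg
    have hg' : g ∈ Subalgebra.toSubmodule
      (Algebra.adjoin ℝ (MonoidHom.mrange (expo U) : Set C(U, ℝ))) := hg
    rw [Algebra.adjoin_eq_span, Submonoid.closure_eq] at hg'
    refine Submodule.span_le.2 ?_ hg'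
    rintro _ ⟨w, rfl⟩
    exact expo_mem w
  exact closure_minimal hle (Submodule.isClosed_topologicalClosure _) hf

def Realiz (U : Set (Fin d → ℝ)) (R : ℝ) (F : U → Fin d → ℝ) : Prop :=
  ∃ (ι : Type) (_ : Fintype ι) (a w : ι → Fin d → ℝ) (b : ι → ℝ),
    (∀ j p, |a j p| < R) ∧ (∀ j q, |w j q| < R) ∧
    ∀ x p, F x p = ∑ j, a j p * relu (∑ q, w j q * x.1 q + b j)

lemma Realiz.zero (R : ℝ) : Realiz U R 0 :=
  ⟨Empty, inferInstance, nofun, nofun, nofun, nofun, nofun, by simp⟩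

lemma Realiz.add {R : ℝ} {F G : U → Fin d → ℝ} (hF : Realiz U R F) (hG : Realiz U R G) :
    Realiz U R (F + G) := by
  obtain ⟨ι, _, a, w, b, ha, hw, h⟩ := hF
  obtain ⟨κ, _, a', w', b', ha', hw', h'⟩ := hG
  refine ⟨ι ⊕ κ, inferInstance, Sum.elim a a', Sum.elim w w', Sum.elim b b', ?_, ?_, ?_⟩
  · rintro (j | j) p <;> simp [ha, ha']
  · rintro (j | j) p <;> simp [hw, hw']
  · intro x p
    simp [Fintype.sum_sum_type, h, h']

lemma relu_mul {c : ℝ} (hc : 0 ≤ c) (t : ℝ) : relu (c * t) = c * relu t := by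
  unfold relu; rw [mul_max_of_nonneg _ _ hc, mul_zero]

lemma Realiz.neuron {R : ℝ} (hR : 0 < R) (v w : Fin d → ℝ) (b : ℝ) :
    Realiz U R (fun x => (neur w b : C(U, ℝ)) x • v) := by
  have hS : 0 ≤ ∑ q, |w q| := Finset.sum_nonneg fun _ _ => abs_nonneg _
  set S := ∑ q, |w q| with hSdef
  have hT : 0 ≤ ∑ q, |v q| := Finset.sum_nonneg fun _ _ => abs_nonneg _
  set T := ∑ q, |v q| with hTdef
  set c := R / (S + 1) with hc
  have hc0 : 0 < c := by positivity
  obtain ⟨N, hN⟩ := exists_nat_gt (T / (c * R))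
  have hN0 : (0 : ℝ) < N := lt_of_le_of_lt (by positivity) hN
  refine ⟨Fin N, inferInstance, fun _ p => v p / (c * N), fun _ q => c * w q, fun _ => c * b,
    ?_, ?_, ?_⟩
  · intro _ p
    have h1 : |v p| ≤ T := Finset.single_le_sum (f := fun q => |v q|)
      (fun _ _ => abs_nonneg _) (Finset.mem_univ p)
    rw [abs_div, abs_of_pos (by positivity : 0 < c * (N : ℝ)), div_lt_iff₀ (by positivity)]
    rw [div_lt_iff₀ (by positivity)] at hN
    nlinarith
  · intro _ q
    have h1 : |w q| ≤ S := Finset.single_le_sum (f := fun q => |w q|)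
      (fun _ _ => abs_nonneg _) (Finset.mem_univ q)
    rw [abs_mul, abs_of_pos hc0, hc, div_mul_eq_mul_div, div_lt_iff₀ (by positivity)]
    nlinarith
  · intro x p
    have : ∀ x : U, ∑ q, c * w q * x.1 q + c * b = c * (∑ q, w q * x.1 q + b) := by
      intro x; rw [mul_add, Finset.mul_sum]; simp [mul_assoc]
    simp only [this, relu_mul hc0.le, Finset.sum_const, Finset.card_univ, Fintype.card_fin,
      nsmul_eq_mul, neur, ContinuousMap.coe_mk, Pi.smul_apply, smul_eq_mul]
    field_simp

lemma Realiz.span {R : ℝ} (hR : 0 < R) {f : C(U, ℝ)} (hf : f ∈ neurSpan U) :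
    ∀ v : Fin d → ℝ, Realiz U R (fun x => f x • v) := by
  induction hf using Submodule.span_induction with
  | mem f hf =>
    obtain ⟨⟨w, b⟩, rfl⟩ := hf
    exact fun v => Realiz.neuron hR v w b
  | zero =>
    intro v
    convert Realiz.zero (U := U) R using 1
    ext; simp
  | add f g _ _ hf hg =>
    intro v
    convert (hf v).add (hg v) using 1
    ext; simp [add_mul]
  | smul c f _ hf =>
    intro v
    convert hf (c • v) using 1
    ext; simp; ring

lemma Realiz.sum {R : ℝ} {κ : Type} (s : Finset κ) {F : κ → U → Fin d → ℝ}
    (h : ∀ k, Realiz U R (F k)) : Realiz U R (∑ k ∈ s, F k) := by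
  classical
  induction s using Finset.induction_on with
  | empty => simpa using Realiz.zero R
  | insert k s hk ih => rw [Finset.sum_insert hk]; exact (h k).add ih

lemma Realiz.approx [CompactSpace U] {R : ℝ} (hR : 0 < R) (g : (Fin d → ℝ) → Fin d → ℝ)
    (hg : Continuous g) {η : ℝ} (hη : 0 < η) :
    ∃ F, Realiz U R F ∧ ∀ (x : U) p, |g x.1 p - F x p| < η := by
  have : ∀ p : Fin d, ∃ f ∈ neurSpan U, ∀ x : U, |g x.1 p - f x| < η := by
    intro p
    let G : C(U, ℝ) := ⟨fun x => g x.1 p,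
      (continuous_apply p).comp (hg.comp continuous_subtype_val)⟩
    have hG : G ∈ (neurSpan U).topologicalClosure := by rw [neur_dense]; trivial
    obtain ⟨f, hf, hd⟩ := Metric.mem_closure_iff.1 hG η hη
    exact ⟨f, hf, fun x => lt_of_le_of_lt (ContinuousMap.dist_apply_le_dist (f := G) (g := f) x) hd⟩
  choose f hf hfd using this
  refine ⟨∑ p, fun x => f p x • Pi.single p 1,
    Realiz.sum _ fun p => Realiz.span hR (hf p) _, fun x p => ?_⟩
  have : (∑ p, fun x : U => f p x • (Pi.single p 1 : Fin d → ℝ)) x p = f p x := by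
    simp [Finset.sum_apply, Pi.single_apply]
  rw [this]
  exact hfd p x

lemma perturb [CompactSpace U] {ι : Type} [Fintype ι] (g : (Fin d → ℝ) → Fin d → ℝ)
    (hg : Continuous g) {η : ℝ} (a w : ι → Fin d → ℝ) (b : ι → ℝ)
    (h : ∀ (x : U) p, |g x.1 p - ∑ j, a j p * relu (∑ q, w j q * x.1 q + b j)| < η) :
    ∃ r > 0, ∀ a' w' : ι → Fin d → ℝ, (∀ j p, |a' j p - a j p| < r) →
      (∀ j p, |w' j p - w j p| < r) →
      ∀ (x : U) p, |g x.1 p - ∑ j, a' j p * relu (∑ q, w' j q * x.1 q + b j)| < η := by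
  have hopen : IsOpen {θ : (ι → Fin d → ℝ) × (ι → Fin d → ℝ) | ∀ x ∈ (Set.univ : Set (U × Fin d)),
      |g x.1.1 x.2 - ∑ j, θ.1 j x.2 * relu (∑ q, θ.2 j q * x.1.1 q + b j)| < η} := by
    have hc : Continuous fun y : ((ι → Fin d → ℝ) × (ι → Fin d → ℝ)) × (U × Fin d) =>
        |g y.2.1.1 y.2.2 - ∑ j, y.1.1 j y.2.2 * relu (∑ q, y.1.2 j q * y.2.1.1 q + b j)| := by
      have hx : Continuous fun y : ((ι → Fin d → ℝ) × (ι → Fin d → ℝ)) × (U × Fin d) => y.2.1.1 := by fun_prop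
      have ev : ∀ {F : ((ι → Fin d → ℝ) × (ι → Fin d → ℝ)) × (U × Fin d) → Fin d → ℝ}, Continuous F →
          Continuous fun y => F y y.2.2 := by
        intro F hF
        have : Continuous fun z : (Fin d → ℝ) × Fin d => z.1 z.2 := by
          rw [continuous_prod_of_discrete_right]
          exact fun p => continuous_apply p
        exact this.comp (hF.prodMk (by fun_prop))
      refine (Continuous.sub (ev (hg.comp hx)) (continuous_finsetSum _ fun j _ => ?_)).abs
      refine (ev (by fun_prop)).mul (relu_continuous.comp (Continuous.add ?_ continuous_const))
      exact continuous_finsetSum _ fun q _ => Continuous.mul (by fun_prop)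
        ((continuous_apply q).comp hx)
    have hO := isOpen_lt hc (continuous_const (y := η))
    rw [isOpen_iff_mem_nhds]
    intro θ hθ
    obtain ⟨u, v, hu, _, hθu, hv, huv⟩ := generalized_tube_lemma (s := {θ})
      isCompact_singleton (t := (Set.univ : Set (U × Fin d))) isCompact_univ hO
      (by rintro ⟨θ', x⟩ ⟨h1, h2⟩; obtain rfl : θ' = θ := h1; exact hθ x h2)
    filter_upwards [hu.mem_nhds (hθu rfl)] with θ' h' x hx
    exact huv (Set.mk_mem_prod h' (hv hx))
  obtain ⟨r, hr, hball⟩ := Metric.isOpen_iff.1 hopen (a, w) (fun x _ => h x.1 x.2)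
  refine ⟨r, hr, fun a' w' ha hw x p => ?_⟩
  have : (a', w') ∈ Metric.ball (a, w) r := by
    rw [Metric.mem_ball, Prod.dist_eq, max_lt_iff]
    constructor
    · exact (dist_pi_lt_iff hr).2 fun j => (dist_pi_lt_iff hr).2 fun p => ha j p
    · exact (dist_pi_lt_iff hr).2 fun j => (dist_pi_lt_iff hr).2 fun p => hw j p
  exact hball this (x, p) trivial

lemma group_meas {ι κ : Type} [Fintype ι] (μ : ι → Measure ℝ)
    [∀ i, IsProbabilityMeasure (μ i)] (ν : ι → κ) (t : ι → Set ℝ) (S : Finset κ) :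
    Measure.pi μ (⋂ k ∈ S, {ω | ∀ i, ν i = k → ω i ∈ t i})
      = ∏ k ∈ S, Measure.pi μ {ω | ∀ i, ν i = k → ω i ∈ t i} := by
  classical
  have h1 : ∀ S : Finset κ, Measure.pi μ (⋂ k ∈ S, {ω | ∀ i, ν i = k → ω i ∈ t i})
      = ∏ i, if ν i ∈ S then μ i (t i) else 1 := by
    intro S
    have : (⋂ k ∈ S, {ω : ι → ℝ | ∀ i, ν i = k → ω i ∈ t i})
        = Set.pi Set.univ (fun i => if ν i ∈ S then t i else Set.univ) := by
      ext ω
      simp only [Set.mem_iInter, Set.mem_ofPred_eq, Set.mem_pi, Set.mem_univ, true_implies]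
      constructor
      · intro h i
        split_ifs with hi
        · exact h _ hi i rfl
        · trivial
      · rintro h k hk i rfl
        simpa [hk] using h i
    rw [this, Measure.pi_pi]
    refine Finset.prod_congr rfl fun i _ => ?_
    split_ifs <;> simp
  have h2 : ∀ k, Measure.pi μ {ω | ∀ i, ν i = k → ω i ∈ t i}
      = ∏ i, if ν i = k then μ i (t i) else 1 := by
    intro k
    simpa using h1 {k}
  rw [h1]
  simp_rw [h2]
  rw [Finset.prod_comm]
  refine Finset.prod_congr rfl fun i _ => ?_
  rw [Finset.prod_ite_eq]

lemma group_compl {ι κ : Type} [Fintype ι] (μ : ι → Measure ℝ)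
    [∀ i, IsProbabilityMeasure (μ i)] (ν : ι → κ) (t : ι → Set ℝ)
    (ht : ∀ i, MeasurableSet (t i)) (S : Finset κ) :
    Measure.pi μ (⋂ k ∈ S, {ω | ∀ i, ν i = k → ω i ∈ t i}ᶜ)
      = ∏ k ∈ S, (1 - Measure.pi μ {ω | ∀ i, ν i = k → ω i ∈ t i}) := by
  have hm : ∀ k, MeasurableSet {ω : ι → ℝ | ∀ i, ν i = k → ω i ∈ t i} := by
    intro k
    simp only [Set.ofPred_forall]
    exact MeasurableSet.iInter fun i => MeasurableSet.iInter fun _ => measurable_pi_apply i (ht i)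
  have hi : ProbabilityTheory.iIndepSet (fun k => {ω : ι → ℝ | ∀ i, ν i = k → ω i ∈ t i})
      (Measure.pi μ) :=
    (ProbabilityTheory.iIndepSet_iff_meas_biInter hm).2 fun S => group_meas μ ν t S
  rw [ProbabilityTheory.iIndepSet_iff_iIndep] at hi
  rw [hi.meas_biInter]
  · exact Finset.prod_congr rfl fun k _ => prob_compl_eq_one_sub (hm k)
  · intro k _
    exact (MeasurableSpace.measurableSet_generateFrom (Set.mem_singleton _)).compl

lemma unif_prob {R : ℝ} (hR : 0 < R) : IsProbabilityMeasure (unif R) := by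
  constructor
  have : volume (Set.Icc (-R) R) ≠ 0 := by simp [hR]
  simp only [unif, Measure.smul_apply, Measure.restrict_apply_univ, smul_eq_mul]
  exact ENNReal.inv_mul_cancel this (by simp)

lemma unif_pos {R : ℝ} {a r : ℝ} (ha : |a| < R) (hr : 0 < r) :
    0 < unif R (Metric.ball a r) := by
  have h0 : 0 < volume (Metric.ball a r ∩ Set.Ioo (-R) R) :=
    (Metric.isOpen_ball.inter isOpen_Ioo).measure_pos _
      ⟨a, Metric.mem_ball_self hr, abs_lt.1 ha⟩
  have h1 : 0 < volume (Metric.ball a r ∩ Set.Icc (-R) R) :=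
    lt_of_lt_of_le h0 (measure_mono (Set.inter_subset_inter_right _ Set.Ioo_subset_Icc_self))
  simp only [unif, Measure.smul_apply, smul_eq_mul,
    Measure.restrict_apply measurableSet_ball]
  exact ENNReal.mul_pos (by simp) h1.ne'

/-- which neuron does a weight belong to -/
def nidx {m d : ℕ} : ResWeightIdx m d → Fin m := Sum.elim Prod.snd Prod.fst

lemma hit_prob {κ : Type} [Fintype κ] {R r δ : ℝ} (hR : 0 < R) (hr : 0 < r) (hδ : 0 < δ)
    (a w : κ → Fin d → ℝ) (ha : ∀ j p, |a j p| < R) (hw : ∀ j p, |w j p| < R) :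
    ∃ (m K : ℕ) (e : κ × Fin K ≃ Fin m), ENNReal.ofReal (1 - δ) ≤
      Measure.pi (fun _ : ResWeightIdx m d => unif R)
        {ω | ∀ j, ∃ k, (∀ p, |ω (Sum.inl (p, e (j, k))) - a j p| < r) ∧
          (∀ q, |ω (Sum.inr (e (j, k), q)) - w j q| < r)} := by
  classical
  have := unif_prob hR
  let Q : κ → ENNReal := fun j =>
    (∏ p, unif R (Metric.ball (a j p) r)) * ∏ q, unif R (Metric.ball (w j q) r)
  have hQ : ∀ j, 0 < Q j := fun j => ENNReal.mul_pos
    (Finset.prod_ne_zero_iff.2 fun p _ => (unif_pos (ha j p) hr).ne')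
    (Finset.prod_ne_zero_iff.2 fun p _ => (unif_pos (hw j p) hr).ne')
  have hlim : Filter.Tendsto (fun K : ℕ => ∑ j, (1 - Q j) ^ K) Filter.atTop (nhds 0) := by
    have : Filter.Tendsto (fun K : ℕ => ∑ j, (1 - Q j) ^ K) Filter.atTop
        (nhds (∑ _j : κ, 0)) :=
      tendsto_finsetSum _ fun j _ => ENNReal.tendsto_pow_atTop_nhds_zero_of_lt_one
        (ENNReal.sub_lt_self (by simp) (by simp) (hQ j).ne')
    simpa using this
  obtain ⟨K, hK⟩ := (hlim.eventually_lt_const (ENNReal.ofReal_pos.2 hδ)).exists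
  obtain ⟨m, ⟨e⟩⟩ : ∃ m : ℕ, Nonempty (κ × Fin K ≃ Fin m) := ⟨_, ⟨Fintype.equivFin _⟩⟩
  refine ⟨m, K, e, ?_⟩
  let t : ResWeightIdx m d → Set ℝ := Sum.elim
    (fun z => Metric.ball (a (e.symm z.2).1 z.1) r) (fun z => Metric.ball (w (e.symm z.1).1 z.2) r)
  have ht : ∀ i, MeasurableSet (t i) := by
    rintro (i | i) <;> exact measurableSet_ball
  set P := Measure.pi (fun _ : ResWeightIdx m d => unif R) with hP
  let E : Fin m → Set (ResWeightIdx m d → ℝ) := fun k => {ω | ∀ i, nidx i = k → ω i ∈ t i}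
  have hE : ∀ k, MeasurableSet (E k) := by
    intro k
    simp only [E, Set.ofPred_forall]
    exact MeasurableSet.iInter fun i => MeasurableSet.iInter fun _ => measurable_pi_apply i (ht i)
  have hPE : ∀ k, P (E k) = Q (e.symm k).1 := by
    intro k
    have : E k = Set.pi Set.univ (fun i => if nidx i = k then t i else Set.univ) := by
      ext ω
      simp only [E, Set.mem_ofPred_eq, Set.mem_pi, Set.mem_univ, true_implies]
      refine forall_congr' fun i => ?_
      split_ifs with hi <;> simp [hi]
    rw [this, hP, Measure.pi_pi, Fintype.prod_sum_type, Fintype.prod_prod_type,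
      Fintype.prod_prod_type_right]
    refine congrArg₂ (· * ·) ?_ ?_
    · refine Finset.prod_congr rfl fun p _ => ?_
      rw [Finset.prod_eq_single k]
      · rw [if_pos (show nidx (Sum.inl (p, k) : ResWeightIdx m d) = k from rfl)]
        rfl
      · intro l _ hl
        rw [if_neg (show nidx (Sum.inl (p, l) : ResWeightIdx m d) ≠ k from hl), measure_univ]
      · exact fun hk => absurd (Finset.mem_univ k) hk
    · refine Finset.prod_congr rfl fun p _ => ?_
      rw [Finset.prod_eq_single k]
      · rw [if_pos (show nidx (Sum.inr (k, p) : ResWeightIdx m d) = k from rfl)]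
        rfl
      · intro l _ hl
        rw [if_neg (show nidx (Sum.inr (l, p) : ResWeightIdx m d) ≠ k from hl), measure_univ]
      · exact fun hk => absurd (Finset.mem_univ k) hk
  let B : κ → Set (ResWeightIdx m d → ℝ) := fun j =>
    ⋂ k ∈ Finset.univ.image (fun l : Fin K => e (j, l)), (E k)ᶜ
  have hB : ∀ j, P (B j) = (1 - Q j) ^ K := by
    intro j
    simp only [B, hP]
    rw [group_compl _ nidx t ht, Finset.prod_image]
    · rw [Finset.prod_congr rfl (g := fun _ => 1 - Q j)]
      · simp
      · intro l _
        have := hPE (e (j, l))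
        simp only [hP, E, Equiv.symm_apply_apply] at this
        rw [this]
    · intro l _ l' _ h
      simpa using h
  have hBm : MeasurableSet (⋃ j, B j) := MeasurableSet.iUnion fun j =>
    Finset.measurableSet_biInter _ fun k _ => (hE k).compl
  have hU : P (⋃ j, B j) ≤ ENNReal.ofReal δ :=
    (measure_iUnion_fintype_le _ _).trans (by simp_rw [hB]; exact hK.le)
  calc ENNReal.ofReal (1 - δ) = 1 - ENNReal.ofReal δ := by
        rw [ENNReal.ofReal_sub _ hδ.le, ENNReal.ofReal_one]
    _ ≤ 1 - P (⋃ j, B j) := tsub_le_tsub_left hU _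
    _ = P (⋃ j, B j)ᶜ := (prob_compl_eq_one_sub hBm).symm
    _ ≤ _ := by
        apply measure_mono
        intro ω hω j
        have hj : ω ∉ B j := fun h => hω (Set.mem_iUnion.2 ⟨j, h⟩)
        simp only [B, Set.mem_iInter, not_forall, Finset.mem_image, Finset.mem_univ,
          true_and, Set.mem_compl_iff, not_not] at hj
        obtain ⟨_, ⟨l, rfl⟩, hl⟩ := hj
        refine ⟨l, fun p => ?_, fun q => ?_⟩
        · simpa [t, Real.dist_eq] using hl (Sum.inl (p, e (j, l))) rfl
        · simpa [t, Real.dist_eq] using hl (Sum.inr (e (j, l), q)) rfl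

end

/-- Bias-learning universal approximation for single-hidden-layer residual networks:
for any continuous target `h : ℝ^d → ℝ^d` on a compact `U`, any `ε > 0`, `δ ∈ (0,1)`,
and `R > 0`, there is a hidden width `m` such that, with all entries of the weight
matrices mutually independent and uniform on `[-R, R]`, with probability at least
`1 - δ` there exists a bias vector `b` such that the res-net
`x ↦ x + A·ReLU(Bx + b)` is `ε`-close to `h` in `L¹(U)`. -/
theorem bias_learning_resnet_universal
    (d : ℕ) (hd : 1 ≤ d)
    (U : Set (Fin d → ℝ)) (hU : IsCompact U)
    (h : (Fin d → ℝ) → Fin d → ℝ) (hh : Continuous h)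
    (ε δ R : ℝ) (hε : 0 < ε) (hδ : δ ∈ Set.Ioo (0 : ℝ) 1) (hR : 0 < R) :
    ∃ m : ℕ,
      ENNReal.ofReal (1 - δ) ≤
        Measure.pi (fun _ : ResWeightIdx m d => unif R)
          {ω | ∃ b : Fin m → ℝ,
            (∫ x in U, ∑ p, |h x p -
              (x p + ∑ i, ω (Sum.inl (p, i)) *
                relu (∑ q, ω (Sum.inr (i, q)) * x q + b i))|) ≤ ε} := by
  classical
  have : CompactSpace U := isCompact_iff_compactSpace.1 hU
  have hd0 : (0 : ℝ) < d := by exact_mod_cast hd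
  have hV : 0 ≤ volume.real U := measureReal_nonneg
  set η := ε / (d * (volume.real U + 1)) with hη
  have hη0 : 0 < η := by positivity
  have hg : Continuous fun x => h x - x := hh.sub continuous_id
  obtain ⟨F, ⟨κ, _, a, w, b, ha, hw, hF⟩, hFg⟩ := Realiz.approx (U := U) hR _ hg hη0
  simp_rw [hF] at hFg
  obtain ⟨r, hr, hpert⟩ := perturb _ hg a w b hFg
  obtain ⟨m, K, e, hm⟩ := hit_prob hR hr hδ.1 a w ha hw
  refine ⟨m, hm.trans (measure_mono ?_)⟩
  intro ω hω
  choose k hk1 hk2 using hω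
  have hC : ∀ i : Fin m, ∃ C : ℝ, ∀ x ∈ U, ∑ q, ω (Sum.inr (i, q)) * x q ≤ C := by
    intro i
    refine ⟨‖(lin (fun q => ω (Sum.inr (i, q))) : C(U, ℝ))‖, fun x hx => ?_⟩
    exact (le_abs_self _).trans
      ((lin (fun q => ω (Sum.inr (i, q))) : C(U, ℝ)).norm_coe_le_norm ⟨x, hx⟩)
  choose C hC using hC
  let b' : Fin m → ℝ := fun i =>
    if (e.symm i).2 = k (e.symm i).1 then b (e.symm i).1 else - C i
  refine ⟨b', ?_⟩
  have hsum : ∀ x ∈ U, ∀ p, ∑ i, ω (Sum.inl (p, i)) *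
      relu (∑ q, ω (Sum.inr (i, q)) * x q + b' i)
      = ∑ j, ω (Sum.inl (p, e (j, k j))) *
        relu (∑ q, ω (Sum.inr (e (j, k j), q)) * x q + b j) := by
    intro x hx p
    rw [← e.sum_comp, Fintype.sum_prod_type]
    refine Finset.sum_congr rfl fun j _ => ?_
    rw [Finset.sum_eq_single (k j)]
    · simp [b']
    · intro l _ hl
      rw [relu_of_nonpos, mul_zero]
      simp only [b', Equiv.symm_apply_apply, hl, if_false]
      linarith [hC (e (j, l)) x hx]
    · simp
  have hbound : ∀ x ∈ U, ‖∑ p, |h x p - (x p + ∑ i, ω (Sum.inl (p, i)) *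
      relu (∑ q, ω (Sum.inr (i, q)) * x q + b' i))|‖ ≤ d * η := by
    intro x hx
    rw [Real.norm_of_nonneg (Finset.sum_nonneg fun _ _ => abs_nonneg _)]
    calc _ ≤ ∑ _p : Fin d, η := by
          refine Finset.sum_le_sum fun p _ => ?_
          rw [hsum x hx p, ← sub_sub]
          exact (hpert (fun j p => ω (Sum.inl (p, e (j, k j))))
            (fun j q => ω (Sum.inr (e (j, k j), q))) hk1 hk2 ⟨x, hx⟩ p).le
      _ = d * η := by simp
  refine (le_abs_self _).trans
    ((norm_setIntegral_le_of_norm_le_const hU.measure_lt_top hbound).trans ?_)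
  have : d * η = ε / (volume.real U + 1) := by rw [hη]; field_simp
  rw [this, div_mul_eq_mul_div, div_le_iff₀ (by positivity)]
  nlinarith
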